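/- Under the smoothness and convexity assumptions, let 0 < μ⁺ ≤ μ ≤ 1/2, let x, y, v be arbitrary and set x⁺ := x − α(∇_x F(x,y) − ∇²_{xy} ψ_μ(x,y) v) for a step size α > 0. Then Φ_{μ⁺}(x⁺) − Φ_μ(x) ≤ −(α/2)‖∇Φ_μ(x)‖² − (1/2)(1/α − (C_{Φ1}‖v*_μ(x)‖ + C_{Φ2})/σ_{ψμ}²)‖x⁺ − x‖² + α(L_{ψxy2}‖v*_μ(x)‖ + L_{Fx2})² ‖y − y*_μ(x)‖² + α L_{ψy1}² ‖v − v*_μ(x)‖² + (2‖∇_y F(x⁺, y*_{μ⁺}(x⁺))‖²/σ_F) · ((μ − μ⁺)/μ), where C_{Φ1} := L_{ψy1}² L_{ψyy2} + L_{ψy1}(L_{ψyy1} + L_{ψxy2}) σ_{ψμ} + L_{ψxy1} σ_{ψμ}² and C_{Φ2} := L_{ψy1}² L_{Fy2} + L_{ψy1}(L_{Fy1} + L_{Fx2}) σ_{ψμ} + L_{Fx1} σ_{ψμ}². -/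

import Mathlib

open Set Filter Asymptotics
open scoped NNReal

noncomputable section

/-- `ℝⁿ` as a Euclidean space. -/
abbrev Eu (n : ℕ) : Type := EuclideanSpace ℝ (Fin n)

variable {n m : ℕ}

/-- Partial gradient with respect to the first (upper-level) variable. -/
def gradx (F : Eu n → Eu m → ℝ) (x : Eu n) (y : Eu m) : Eu n :=
  gradient (fun x' => F x' y) x

/-- Partial gradient with respect to the second (lower-level) variable. -/
def grady (F : Eu n → Eu m → ℝ) (x : Eu n) (y : Eu m) : Eu m :=
  gradient (fun y' => F x y') y

/-- Second-order partial derivative `∇²_{yy}`. -/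
def hessyy (F : Eu n → Eu m → ℝ) (x : Eu n) (y : Eu m) : Eu m →L[ℝ] Eu m :=
  fderiv ℝ (fun y' => grady F x y') y

/-- Mixed second-order partial derivative `∇²_{xy}`, viewed as the linear map
sending a multiplier `v ∈ ℝᵐ` to an element of `ℝⁿ`. -/
def hessxy (F : Eu n → Eu m → ℝ) (x : Eu n) (y : Eu m) : Eu m →L[ℝ] Eu n :=
  ContinuousLinearMap.adjoint (fderiv ℝ (fun x' => grady F x' y) x)

/-- The aggregation function `ψ_μ = μ F + (1-μ) f`. -/
def aggreg (μ : ℝ) (F f : Eu n → Eu m → ℝ) : Eu n → Eu m → ℝ :=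
  fun x y => μ * F x y + (1 - μ) * f x y

/-- The squared KKT residual of the equality-constrained reformulation
`min F(x,y) s.t. ∇_y f(x,y) = 0`. -/
def KKTres (F f : Eu n → Eu m → ℝ) (x : Eu n) (y v : Eu m) : ℝ :=
  ‖gradx F x y - hessxy f x y v‖ ^ 2 + ‖grady F x y - hessyy f x y v‖ ^ 2 +
    ‖grady f x y‖ ^ 2

section StrongConvexity

variable {E : Type*} [NormedAddCommGroup E] [InnerProductSpace ℝ E]

/-- First-order lower bound for a differentiable strongly convex function. -/
theorem StrongConvexOn.add_inner_add_le [CompleteSpace E] {f : E → ℝ} {c : ℝ}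
    (hf : StrongConvexOn univ c f) {g w : E} (hg : HasGradientAt f g w) (z : E) :
    f w + inner ℝ g (z - w) + c / 2 * ‖z - w‖ ^ 2 ≤ f z := by
  have hd : HasDerivAt (fun t : ℝ => f (w + t • (z - w))) (inner ℝ g (z - w)) 0 := by
    have h1 : HasDerivAt (fun t : ℝ => w + t • (z - w)) (z - w) 0 := by
      simpa using ((hasDerivAt_id (0 : ℝ)).smul_const (z - w)).const_add w
    have h2 : HasFDerivAt f (InnerProductSpace.toDual ℝ E g) (w + (0 : ℝ) • (z - w)) := by
      simpa using hg.hasFDerivAt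
    simpa [Function.comp_def] using h2.comp_hasDerivAt (0 : ℝ) h1
  have hlim := hd.tendsto_slope_zero_right
  have hbound : Tendsto (fun t : ℝ => f z - f w - (1 - t) * (c / 2 * ‖z - w‖ ^ 2))
      (nhdsWithin 0 (Ioi 0)) (nhds (f z - f w - (1 - 0) * (c / 2 * ‖z - w‖ ^ 2))) := by
    refine (Continuous.tendsto ?_ 0).mono_left nhdsWithin_le_nhds
    fun_prop
  have hev : ∀ᶠ t : ℝ in nhdsWithin 0 (Ioi 0), t ∈ Ioo (0 : ℝ) 1 := Ioo_mem_nhdsGT one_pos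
  have := le_of_tendsto_of_tendsto hlim hbound (by
    filter_upwards [hev] with t ht
    have hc := hf.2 (mem_univ w) (mem_univ z) (sub_nonneg.2 ht.2.le) ht.1.le (by ring)
    have he : (1 - t) • w + t • z = w + t • (z - w) := by module
    rw [he, norm_sub_rev] at hc
    simp only [smul_eq_mul, zero_add, zero_smul, add_zero] at hc ⊢
    rw [inv_mul_le_iff₀ ht.1]
    nlinarith [hc])
  linarith

/-- The gradient of a differentiable strongly convex function is strongly monotone. -/
theorem StrongConvexOn.le_inner_gradient_sub [CompleteSpace E] {f : E → ℝ} {c : ℝ}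
    (hf : StrongConvexOn univ c f) {g h w z : E} (hg : HasGradientAt f g w)
    (hh : HasGradientAt f h z) :
    c * ‖z - w‖ ^ 2 ≤ inner ℝ (h - g) (z - w) := by
  have h1 := hf.add_inner_add_le hg z
  have h2 := hf.add_inner_add_le hh w
  rw [← neg_sub z w, inner_neg_right, norm_neg] at h2
  rw [inner_sub_left]
  linarith

/-- The derivative of a strongly monotone map is coercive. -/
theorem le_inner_fderiv_of_strongMonotone {G : E → E} {B : E →L[ℝ] E} {y : E} {c : ℝ}
    (hG : HasFDerivAt G B y) (hmono : ∀ z, c * ‖z - y‖ ^ 2 ≤ inner ℝ (G z - G y) (z - y))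
    (u : E) : c * ‖u‖ ^ 2 ≤ inner ℝ (B u) u := by
  have hd : HasDerivAt (fun t : ℝ => G (y + t • u)) (B u) 0 := by
    have h1 : HasDerivAt (fun t : ℝ => y + t • u) u 0 := by
      simpa using ((hasDerivAt_id (0 : ℝ)).smul_const u).const_add y
    have h2 : HasFDerivAt G B (y + (0 : ℝ) • u) := by simpa using hG
    exact h2.comp_hasDerivAt (0 : ℝ) h1
  have hlim := hd.tendsto_slope_zero_right.inner (𝕜 := ℝ)
    (tendsto_const_nhds (x := u) (f := nhdsWithin (0 : ℝ) (Ioi 0)))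
  refine ge_of_tendsto hlim ?_
  filter_upwards [self_mem_nhdsWithin] with t ht
  have ht' : (0 : ℝ) < t := ht
  have h := hmono (y + t • u)
  simp only [add_sub_cancel_left, norm_smul, Real.norm_eq_abs, mul_pow, sq_abs,
    inner_smul_right] at h
  simp only [zero_add, zero_smul, add_zero, inner_smul_left, map_inv₀, conj_trivial]
  rw [le_inv_mul_iff₀ ht']
  refine le_of_mul_le_mul_left ?_ ht'
  linarith

/-- A coercive operator expands norms by at least its coercivity constant. -/
theorem ContinuousLinearMap.mul_norm_le_of_le_inner {B : E →L[ℝ] E} {c : ℝ}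
    (hB : ∀ u, c * ‖u‖ ^ 2 ≤ inner ℝ (B u) u) (u : E) : c * ‖u‖ ≤ ‖B u‖ := by
  rcases eq_or_ne u 0 with rfl | hu
  · simp
  · refine le_of_mul_le_mul_right ?_ (norm_pos_iff.2 hu)
    have := (hB u).trans (real_inner_le_norm _ _)
    linarith

theorem ContinuousLinearMap.isInvertible_of_le_inner [FiniteDimensional ℝ E] {B : E →L[ℝ] E}
    {c : ℝ} (hc : 0 < c) (hB : ∀ u, c * ‖u‖ ^ 2 ≤ inner ℝ (B u) u) : B.IsInvertible := by
  have hinj : Function.Injective (B : E →ₗ[ℝ] E) := by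
    refine (injective_iff_map_eq_zero _).2 fun u hu => ?_
    have h := B.mul_norm_le_of_le_inner hB u
    rw [show B u = 0 from hu, norm_zero] at h
    have : ‖u‖ ≤ 0 := by by_contra! hn; nlinarith
    exact norm_le_zero_iff.1 this
  refine ⟨(LinearEquiv.ofInjectiveEndo (B : E →ₗ[ℝ] E) hinj).toContinuousLinearEquiv, ?_⟩
  ext u
  rfl

theorem ContinuousLinearMap.IsInvertible.apply_inverse_self {B : E →L[ℝ] E}
    (hB : B.IsInvertible) (u : E) : B (B.inverse u) = u :=
  ((hB.inverse_apply_eq).1 rfl).symm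

/-- Quadratic upper bound from a gradient whose variation around a base point is linearly
controlled. -/
theorem le_add_inner_add_of_norm_gradient_sub_le [CompleteSpace E] {Φ : E → ℝ} {g : E → E}
    {x : E} {L : ℝ} (hΦ : ∀ z, HasGradientAt Φ (g z) z)
    (hg : ∀ z, ‖g z - g x‖ ≤ L * ‖z - x‖) (z : E) :
    Φ z ≤ Φ x + inner ℝ (g x) (z - x) + L / 2 * ‖z - x‖ ^ 2 := by
  set d := z - x with hd
  have hder : ∀ t : ℝ, HasDerivAt
      (fun t : ℝ => Φ (x + t • d) - t * inner ℝ (g x) d - t ^ 2 * (L / 2 * ‖d‖ ^ 2))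
      (inner ℝ (g (x + t • d)) d - inner ℝ (g x) d - 2 * t * (L / 2 * ‖d‖ ^ 2)) t := by
    intro t
    have h1 : HasDerivAt (fun t : ℝ => x + t • d) d t := by
      simpa using ((hasDerivAt_id t).smul_const d).const_add x
    have h2 : HasDerivAt (fun t : ℝ => Φ (x + t • d)) (inner ℝ (g (x + t • d)) d) t := by
      simpa [Function.comp_def] using (hΦ (x + t • d)).hasFDerivAt.comp_hasDerivAt t h1
    have h3 : HasDerivAt (fun t : ℝ => t * inner ℝ (g x) d) (inner ℝ (g x) d) t := by
      simpa using (hasDerivAt_id t).mul_const (inner ℝ (g x) d)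
    have h4 : HasDerivAt (fun t : ℝ => t ^ 2 * (L / 2 * ‖d‖ ^ 2))
        (2 * t * (L / 2 * ‖d‖ ^ 2)) t := by
      simpa using (hasDerivAt_pow 2 t).mul_const (L / 2 * ‖d‖ ^ 2)
    exact (h2.sub h3).sub h4
  have hanti : AntitoneOn
      (fun t : ℝ => Φ (x + t • d) - t * inner ℝ (g x) d - t ^ 2 * (L / 2 * ‖d‖ ^ 2))
      (Icc 0 1) := by
    refine antitoneOn_of_deriv_nonpos (convex_Icc 0 1)
      (fun t _ => (hder t).continuousAt.continuousWithinAt)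
      (fun t _ => (hder t).differentiableAt.differentiableWithinAt) fun t ht => ?_
    rw [interior_Icc] at ht
    rw [(hder t).deriv, ← inner_sub_left]
    have h1 := real_inner_le_norm (g (x + t • d) - g x) d
    have h2 := hg (x + t • d)
    rw [add_sub_cancel_left, norm_smul, Real.norm_eq_abs, abs_of_pos ht.1] at h2
    nlinarith [mul_le_mul_of_nonneg_right h2 (norm_nonneg d)]
  have h := hanti (left_mem_Icc.2 zero_le_one) (right_mem_Icc.2 zero_le_one) zero_le_one
  simp only [one_smul, zero_smul, add_zero, hd, add_sub_cancel] at h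
  simp only [hd]
  linarith

end StrongConvexity

section PartialDerivatives

variable {ψ : Eu n → Eu m → ℝ}

theorem hasGradientAt_gradx (hψ : Differentiable ℝ (Function.uncurry ψ)) (x : Eu n) (y : Eu m) :
    HasGradientAt (fun x' => ψ x' y) (gradx ψ x y) x :=
  DifferentiableAt.hasGradientAt
    (DifferentiableAt.comp (g := Function.uncurry ψ) (f := fun x' => (x', y)) x (hψ (x, y))
      (differentiableAt_id.prodMk (differentiableAt_const y)))

theorem hasGradientAt_grady (hψ : Differentiable ℝ (Function.uncurry ψ)) (x : Eu n) (y : Eu m) :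
    HasGradientAt (ψ x) (grady ψ x y) y :=
  DifferentiableAt.hasGradientAt
    ((hψ (x, y)).comp y ((differentiableAt_const x).prodMk differentiableAt_id))

theorem fderiv_uncurry_apply (hψ : Differentiable ℝ (Function.uncurry ψ)) (x a : Eu n)
    (y b : Eu m) : fderiv ℝ (Function.uncurry ψ) (x, y) (a, b) =
      inner ℝ (gradx ψ x y) a + inner ℝ (grady ψ x y) b := by
  have h1 : fderiv ℝ (fun x' => ψ x' y) x =
      (fderiv ℝ (Function.uncurry ψ) (x, y)).comp (ContinuousLinearMap.inl ℝ _ _) :=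
    (HasFDerivAt.comp (g := Function.uncurry ψ) (f := fun x' => (x', y)) x
      (hψ (x, y)).hasFDerivAt (hasFDerivAt_prodMk_left x y)).fderiv
  have h2 : fderiv ℝ (ψ x) y =
      (fderiv ℝ (Function.uncurry ψ) (x, y)).comp (ContinuousLinearMap.inr ℝ _ _) :=
    ((hψ (x, y)).hasFDerivAt.comp y (hasFDerivAt_prodMk_right x y)).fderiv
  have h3 : inner ℝ (gradx ψ x y) a = fderiv ℝ (fun x' => ψ x' y) x a := inner_gradient_left
  have h4 : inner ℝ (grady ψ x y) b = fderiv ℝ (ψ x) y b := inner_gradient_left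
  rw [h3, h4, h1, h2, ContinuousLinearMap.comp_apply, ContinuousLinearMap.comp_apply, ← map_add]
  simp

theorem differentiable_grady (hψ : ContDiff ℝ 2 (Function.uncurry ψ)) :
    Differentiable ℝ (Function.uncurry (grady ψ)) := by
  have hd : Differentiable ℝ (Function.uncurry ψ) := hψ.differentiable (by norm_num)
  have h1 : Differentiable ℝ (fderiv ℝ (Function.uncurry ψ)) :=
    (hψ.fderiv_right (m := 1) (by norm_num)).differentiable (by norm_num)
  have he : Function.uncurry (grady ψ) = fun p => (InnerProductSpace.toDual ℝ (Eu m)).symm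
      ((fderiv ℝ (Function.uncurry ψ) p).comp (ContinuousLinearMap.inr ℝ (Eu n) (Eu m))) := by
    funext p
    rw [LinearIsometryEquiv.eq_symm_apply]
    ext b
    obtain ⟨x, y⟩ := p
    simp [fderiv_uncurry_apply hd]
  rw [he]
  exact (InnerProductSpace.toDual ℝ (Eu m)).symm.toContinuousLinearEquiv.differentiable.comp
    (h1.clm_comp (differentiable_const _))

theorem hasFDerivAt_grady_right (hψ : ContDiff ℝ 2 (Function.uncurry ψ)) (x : Eu n) (y : Eu m) :
    HasFDerivAt (grady ψ x) (hessyy ψ x y) y :=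
  ((differentiable_grady hψ (x, y)).comp y
    ((differentiableAt_const x).prodMk differentiableAt_id)).hasFDerivAt

theorem hasFDerivAt_grady_left (hψ : ContDiff ℝ 2 (Function.uncurry ψ)) (x : Eu n) (y : Eu m) :
    HasFDerivAt (fun x' => grady ψ x' y) (ContinuousLinearMap.adjoint (hessxy ψ x y)) x := by
  rw [hessxy, ContinuousLinearMap.adjoint_adjoint]
  exact (DifferentiableAt.comp (g := Function.uncurry (grady ψ)) (f := fun x' => (x', y)) x
    (differentiable_grady hψ (x, y))
    (differentiableAt_id.prodMk (differentiableAt_const y))).hasFDerivAt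

theorem fderiv_uncurry_grady_apply (hψ : ContDiff ℝ 2 (Function.uncurry ψ)) (x a : Eu n)
    (y b : Eu m) : fderiv ℝ (Function.uncurry (grady ψ)) (x, y) (a, b) =
      ContinuousLinearMap.adjoint (hessxy ψ x y) a + hessyy ψ x y b := by
  have hd := differentiable_grady hψ (x, y)
  rw [(hasFDerivAt_grady_left hψ x y).unique
      (HasFDerivAt.comp (g := Function.uncurry (grady ψ)) (f := fun x' => (x', y)) x
        hd.hasFDerivAt (hasFDerivAt_prodMk_left x y)),
    (hasFDerivAt_grady_right hψ x y).unique
      (hd.hasFDerivAt.comp y (hasFDerivAt_prodMk_right x y)),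
    ContinuousLinearMap.comp_apply, ContinuousLinearMap.comp_apply, ← map_add]
  simp

theorem inner_hessyy_comm (hψ : ContDiff ℝ 2 (Function.uncurry ψ)) (x : Eu n) (y u w : Eu m) :
    inner ℝ (hessyy ψ x y u) w = inner ℝ u (hessyy ψ x y w) := by
  have hx : ContDiff ℝ 2 (ψ x) := hψ.comp (contDiff_const.prodMk contDiff_id)
  have hs : IsSymmSndFDerivAt ℝ (ψ x) y :=
    hx.contDiffAt.isSymmSndFDerivAt (by simp)
  have he : fderiv ℝ (ψ x) = fun y' => InnerProductSpace.toDual ℝ (Eu m) (grady ψ x y') := by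
    funext y'
    exact toDual_gradient.symm
  have hd : fderiv ℝ (fderiv ℝ (ψ x)) y =
      (InnerProductSpace.toDual ℝ (Eu m)).toContinuousLinearEquiv.toContinuousLinearMap.comp
        (hessyy ψ x y) := by
    rw [he]
    exact ((InnerProductSpace.toDual ℝ (Eu m)).toContinuousLinearEquiv.hasFDerivAt.comp y
      (hasFDerivAt_grady_right hψ x y)).fderiv
  have := hs u w
  rw [hd] at this
  rw [real_inner_comm _ u]
  simpa using this

theorem norm_hessxy_le {L : ℝ} (hL : 0 ≤ L) (y : Eu m)
    (hlip : ∀ x x', ‖grady ψ x y - grady ψ x' y‖ ≤ L * ‖x - x'‖) (x : Eu n) :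
    ‖hessxy ψ x y‖ ≤ L := by
  rw [hessxy, LinearIsometryEquiv.norm_map]
  exact norm_fderiv_le_of_lipschitz (C := ⟨L, hL⟩) ℝ
    (LipschitzWith.of_dist_le_mul fun x x' => by
      rw [dist_eq_norm, dist_eq_norm]
      exact hlip x x')

end PartialDerivatives

section Aggregation

variable {F f : Eu n → Eu m → ℝ}

theorem contDiff_aggreg (μ : ℝ) (hF : ContDiff ℝ 2 (Function.uncurry F))
    (hf : ContDiff ℝ 2 (Function.uncurry f)) :
    ContDiff ℝ 2 (Function.uncurry (aggreg μ F f)) :=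
  (contDiff_const.mul hF).add (contDiff_const.mul hf)

theorem grady_aggreg (μ : ℝ) (hF : Differentiable ℝ (Function.uncurry F))
    (hf : Differentiable ℝ (Function.uncurry f)) (x : Eu n) (y : Eu m) :
    grady (aggreg μ F f) x y = μ • grady F x y + (1 - μ) • grady f x y := by
  refine HasGradientAt.gradient ?_
  rw [hasGradientAt_iff_hasFDerivAt]
  refine (((hasGradientAt_grady hF x y).hasFDerivAt.const_mul μ).add
    ((hasGradientAt_grady hf x y).hasFDerivAt.const_mul (1 - μ))).congr_fderiv ?_
  rw [map_add, map_smulₛₗ, map_smulₛₗ, conj_trivial, conj_trivial]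

theorem hessyy_aggreg (μ : ℝ) (hF : ContDiff ℝ 2 (Function.uncurry F))
    (hf : ContDiff ℝ 2 (Function.uncurry f)) (x : Eu n) (y : Eu m) :
    hessyy (aggreg μ F f) x y = μ • hessyy F x y + (1 - μ) • hessyy f x y := by
  have he : grady (aggreg μ F f) x = fun y' => μ • grady F x y' + (1 - μ) • grady f x y' :=
    funext fun y' => grady_aggreg μ (hF.differentiable (by norm_num))
      (hf.differentiable (by norm_num)) x y'
  have h := (((hasFDerivAt_grady_right hF x y).const_smul μ).add
    ((hasFDerivAt_grady_right hf x y).const_smul (1 - μ))).fderiv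
  rw [hessyy, ← h]
  exact congrArg (fun g => fderiv ℝ g y) he

theorem hessxy_aggreg (μ : ℝ) (hF : ContDiff ℝ 2 (Function.uncurry F))
    (hf : ContDiff ℝ 2 (Function.uncurry f)) (x : Eu n) (y : Eu m) :
    hessxy (aggreg μ F f) x y = μ • hessxy F x y + (1 - μ) • hessxy f x y := by
  have he : (fun x' => grady (aggreg μ F f) x' y) =
      fun x' => μ • grady F x' y + (1 - μ) • grady f x' y :=
    funext fun x' => grady_aggreg μ (hF.differentiable (by norm_num))
      (hf.differentiable (by norm_num)) x' y
  have h : fderiv ℝ (fun x' => μ • grady F x' y + (1 - μ) • grady f x' y) x = _ :=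
    (((hasFDerivAt_grady_left hF x y).const_smul μ).add
    ((hasFDerivAt_grady_left hf x y).const_smul (1 - μ))).fderiv
  rw [hessxy, he, h, map_add, map_smulₛₗ, map_smulₛₗ, ContinuousLinearMap.adjoint_adjoint,
    ContinuousLinearMap.adjoint_adjoint, conj_trivial, conj_trivial]

/-- A convex combination of Lipschitz maps is Lipschitz with the combined constant. -/
theorem norm_combo_sub_le {E : Type*} {E' : Type*} [NormedAddCommGroup E]
    [NormedAddCommGroup E'] [NormedSpace ℝ E'] {μ : ℝ} (h0 : 0 ≤ μ) (h1 : μ ≤ 1) {K L : ℝ≥0}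
    {g h : E → E'} (hg : LipschitzWith K g) (hh : LipschitzWith L h) (a b : E) :
    ‖(μ • g a + (1 - μ) • h a) - (μ • g b + (1 - μ) • h b)‖ ≤
      (μ * K + (1 - μ) * L) * ‖a - b‖ := by
  have e : (μ • g a + (1 - μ) • h a) - (μ • g b + (1 - μ) • h b) =
      μ • (g a - g b) + (1 - μ) • (h a - h b) := by module
  have hg' := hg.norm_sub_le a b
  have hh' := hh.norm_sub_le a b
  calc _ ≤ μ * ‖g a - g b‖ + (1 - μ) * ‖h a - h b‖ := by
        rw [e]
        refine (norm_add_le _ _).trans_eq ?_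
        rw [norm_smul, norm_smul, Real.norm_of_nonneg h0, Real.norm_of_nonneg (sub_nonneg.2 h1)]
    _ ≤ μ * (K * ‖a - b‖) + (1 - μ) * (L * ‖a - b‖) := by
        have := sub_nonneg.2 h1
        gcongr
    _ = _ := by ring

theorem strongMonotone_grady_aggreg {μ σ : ℝ} (h0 : 0 ≤ μ) (h1 : μ ≤ 1)
    (hF : Differentiable ℝ (Function.uncurry F)) (hf : Differentiable ℝ (Function.uncurry f))
    {x : Eu n} (hFc : StrongConvexOn univ σ (F x)) (hfc : ConvexOn ℝ univ (f x)) (z w : Eu m) :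
    μ * σ * ‖z - w‖ ^ 2 ≤
      inner ℝ (grady (aggreg μ F f) x z - grady (aggreg μ F f) x w) (z - w) := by
  have hA := hFc.le_inner_gradient_sub (hasGradientAt_grady hF x w) (hasGradientAt_grady hF x z)
  have hB := (strongConvexOn_zero.2 hfc).le_inner_gradient_sub (hasGradientAt_grady hf x w)
    (hasGradientAt_grady hf x z)
  have e : grady (aggreg μ F f) x z - grady (aggreg μ F f) x w =
      μ • (grady F x z - grady F x w) + (1 - μ) • (grady f x z - grady f x w) := by
    rw [grady_aggreg μ hF hf, grady_aggreg μ hF hf]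
    module
  rw [e, inner_add_left, real_inner_smul_left, real_inner_smul_left]
  nlinarith [mul_le_mul_of_nonneg_left hA h0, mul_le_mul_of_nonneg_left hB (sub_nonneg.2 h1)]

theorem grady_eq_zero_of_forall_le {ψ : Eu n → Eu m → ℝ} {x : Eu n} {y : Eu m}
    (h : ∀ z, ψ x y ≤ ψ x z) : grady ψ x y = 0 := by
  have h0 : fderiv ℝ (ψ x) y = 0 :=
    IsLocalMin.fderiv_eq_zero (Filter.Eventually.of_forall h)
  change gradient (ψ x) y = 0
  rw [gradient, h0, map_zero]

end Aggregation

section SolutionMap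

variable {F ψ : Eu n → Eu m → ℝ} {Y : Eu n → Eu m} {σ L : ℝ}

theorem norm_solution_sub_le (hσ : 0 < σ)
    (hmono : ∀ x z w, σ * ‖z - w‖ ^ 2 ≤ inner ℝ (grady ψ x z - grady ψ x w) (z - w))
    (hlip : ∀ y x x', ‖grady ψ x y - grady ψ x' y‖ ≤ L * ‖x - x'‖)
    (hY : ∀ x, grady ψ x (Y x) = 0) (x' x : Eu n) :
    ‖Y x' - Y x‖ ≤ L / σ * ‖x' - x‖ := by
  have h := hmono x' (Y x) (Y x')
  rw [hY x', sub_zero] at h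
  have h2 := hlip (Y x) x' x
  rw [hY x, sub_zero] at h2
  have h3 := h.trans ((real_inner_le_norm _ _).trans
    (mul_le_mul_of_nonneg_right h2 (norm_nonneg _)))
  rw [div_mul_eq_mul_div, le_div_iff₀ hσ, norm_sub_rev (Y x')]
  rcases (norm_nonneg (Y x - Y x')).eq_or_lt with h0 | h0
  · rw [← h0, zero_mul]
    exact (norm_nonneg _).trans h2
  · refine le_of_mul_le_mul_right ?_ h0
    linarith

/-- Implicit differentiation of the solution map of a strongly convex lower-level problem. -/
theorem hasFDerivAt_solution (hψ : ContDiff ℝ 2 (Function.uncurry ψ)) (hσ : 0 < σ)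
    (hmono : ∀ x z w, σ * ‖z - w‖ ^ 2 ≤ inner ℝ (grady ψ x z - grady ψ x w) (z - w))
    (hlip : ∀ y x x', ‖grady ψ x y - grady ψ x' y‖ ≤ L * ‖x - x'‖)
    (hY : ∀ x, grady ψ x (Y x) = 0) (x : Eu n) :
    HasFDerivAt Y (-((hessyy ψ x (Y x)).inverse.comp
      (ContinuousLinearMap.adjoint (hessxy ψ x (Y x))))) x := by
  set B := hessyy ψ x (Y x) with hB
  set A := ContinuousLinearMap.adjoint (hessxy ψ x (Y x)) with hA
  have hcoer : ∀ u, σ * ‖u‖ ^ 2 ≤ inner ℝ (B u) u := fun u =>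
    le_inner_fderiv_of_strongMonotone (hasFDerivAt_grady_right hψ x (Y x))
      (fun z => hmono x z (Y x)) u
  have hinv : B.IsInvertible := B.isInvertible_of_le_inner hσ hcoer
  have hleft : ∀ u, B.inverse (B u) = u := fun u => (hinv.inverse_apply_eq).2 rfl
  have hbig : (fun x' => ((x', Y x') : Eu n × Eu m) - (x, Y x)) =O[nhds x] fun x' => x' - x := by
    have hYO : (fun x' => Y x' - Y x) =O[nhds x] fun x' => x' - x :=
      IsBigO.of_bound (L / σ) (Eventually.of_forall
        fun x' => norm_solution_sub_le hσ hmono hlip hY x' x)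
    exact (isBigO_refl _ _).prod_left hYO
  have hcont : Tendsto (fun x' => ((x', Y x') : Eu n × Eu m)) (nhds x) (nhds (x, Y x)) := by
    rw [tendsto_iff_norm_sub_tendsto_zero, ← isLittleO_one_iff ℝ, isLittleO_norm_left]
    refine hbig.trans_isLittleO ?_
    rw [isLittleO_one_iff]
    exact tendsto_sub_nhds_zero_iff.2 tendsto_id
  have hG := ((differentiable_grady hψ (x, Y x)).hasFDerivAt.isLittleO.comp_tendsto
    hcont).trans_isBigO hbig
  have hlin := (B.inverse.isBigO_comp _ _).trans_isLittleO hG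
  refine HasFDerivAt.of_isLittleO (hlin.neg_left.congr_left fun x' => ?_)
  simp only [Function.comp_apply, Function.uncurry_apply_pair, hY, sub_self, zero_sub, map_neg,
    neg_neg, Prod.mk_sub_mk, fderiv_uncurry_grady_apply hψ, map_add, ← hA, ← hB, hleft]
  simp
  abel

/-- The hypergradient formula. -/
theorem hasGradientAt_comp_solution (hF : Differentiable ℝ (Function.uncurry F))
    (hψ : ContDiff ℝ 2 (Function.uncurry ψ)) (hσ : 0 < σ)
    (hmono : ∀ x z w, σ * ‖z - w‖ ^ 2 ≤ inner ℝ (grady ψ x z - grady ψ x w) (z - w))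
    (hlip : ∀ y x x', ‖grady ψ x y - grady ψ x' y‖ ≤ L * ‖x - x'‖)
    (hY : ∀ x, grady ψ x (Y x) = 0) (x : Eu n) :
    HasGradientAt (fun x' => F x' (Y x')) (gradx F x (Y x) -
      hessxy ψ x (Y x) ((hessyy ψ x (Y x)).inverse (grady F x (Y x)))) x := by
  have hcoer : ∀ u, σ * ‖u‖ ^ 2 ≤ inner ℝ (hessyy ψ x (Y x) u) u := fun u =>
    le_inner_fderiv_of_strongMonotone (hasFDerivAt_grady_right hψ x (Y x))
      (fun z => hmono x z (Y x)) u
  have hinv := (hessyy ψ x (Y x)).isInvertible_of_le_inner hσ hcoer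
  have hsymm : ∀ u w, inner ℝ u ((hessyy ψ x (Y x)).inverse w) =
      inner ℝ ((hessyy ψ x (Y x)).inverse u) w := by
    intro u w
    have := inner_hessyy_comm hψ x (Y x) ((hessyy ψ x (Y x)).inverse u)
      ((hessyy ψ x (Y x)).inverse w)
    rwa [hinv.apply_inverse_self, hinv.apply_inverse_self] at this
  rw [hasGradientAt_iff_hasFDerivAt]
  have h := HasFDerivAt.comp (g := Function.uncurry F) (f := fun x' => (x', Y x')) x
    (hF (x, Y x)).hasFDerivAt
    ((hasFDerivAt_id x).prodMk (hasFDerivAt_solution hψ hσ hmono hlip hY x))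
  refine h.congr_fderiv ?_
  ext a
  simp only [ContinuousLinearMap.comp_apply, ContinuousLinearMap.prod_apply,
    fderiv_uncurry_apply hF, ContinuousLinearMap.id_apply, neg_apply,
    inner_neg_right, InnerProductSpace.toDual_apply_apply, inner_sub_left, hsymm,
    ContinuousLinearMap.adjoint_inner_right]
  ring

end SolutionMap

section Estimates

/-- Stability of `p - H B⁻¹ g` under perturbation of all of its ingredients. -/
theorem norm_sub_apply_inverse_sub_le {E E' : Type*} [NormedAddCommGroup E] [NormedSpace ℝ E]
    [NormedAddCommGroup E'] [InnerProductSpace ℝ E'] {p p' : E} {H H' : E' →L[ℝ] E}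
    {B B' : E' →L[ℝ] E'} {g g' : E'} {σ a b c d k : ℝ} (hσ : 0 < σ) (hB : B.IsInvertible)
    (hB' : B'.IsInvertible) (hcoer : ∀ u, σ * ‖u‖ ^ 2 ≤ inner ℝ (B' u) u)
    (hp : ‖p' - p‖ ≤ a) (hg : ‖g' - g‖ ≤ b) (hBB : ‖B' - B‖ ≤ c) (hHH : ‖H' - H‖ ≤ d)
    (hH : ‖H'‖ ≤ k) :
    ‖(p' - H' (B'.inverse g')) - (p - H (B.inverse g))‖ ≤
      a + k * ((b + c * ‖B.inverse g‖) / σ) + d * ‖B.inverse g‖ := by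
  set v := B.inverse g
  set v' := B'.inverse g'
  have hBv : B v = g := hB.apply_inverse_self g
  have hBv' : B' v' = g' := hB'.apply_inverse_self g'
  have hvv : ‖v' - v‖ ≤ (b + c * ‖v‖) / σ := by
    rw [le_div_iff₀ hσ, mul_comm]
    refine (B'.mul_norm_le_of_le_inner hcoer _).trans ?_
    have e : B' (v' - v) = (g' - g) - (B' - B) v := by
      simp [hBv, hBv']
    rw [e]
    refine (norm_sub_le _ _).trans (add_le_add hg ?_)
    exact (B' - B).le_of_opNorm_le hBB v
  have e : (p' - H' v') - (p - H v) = (p' - p) - H' (v' - v) - (H' - H) v := by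
    simp only [map_sub, sub_apply]
    abel
  rw [e]
  refine (norm_sub_le _ _).trans (add_le_add ((norm_sub_le _ _).trans (add_le_add hp ?_))
    ((H' - H).le_of_opNorm_le hHH v))
  exact (H'.le_of_opNorm_le hH _).trans
    (mul_le_mul_of_nonneg_left hvv ((norm_nonneg _).trans hH))

theorem norm_sub_le_of_partial {X Z W : Type*} [NormedAddCommGroup X] [NormedAddCommGroup Z]
    [NormedAddCommGroup W] {φ : X → Z → W} {K L M : ℝ} (hL : 0 ≤ L)
    (h1 : ∀ z x x', ‖φ x z - φ x' z‖ ≤ K * ‖x - x'‖)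
    (h2 : ∀ x z z', ‖φ x z - φ x z'‖ ≤ L * ‖z - z'‖) {x x' : X} {z z' : Z}
    (h : ‖z' - z‖ ≤ M * ‖x' - x‖) : ‖φ x' z' - φ x z‖ ≤ (K + L * M) * ‖x' - x‖ := by
  calc ‖φ x' z' - φ x z‖ ≤ ‖φ x' z' - φ x' z‖ + ‖φ x' z - φ x z‖ :=
        norm_sub_le_norm_sub_add_norm_sub ..
    _ ≤ L * (M * ‖x' - x‖) + K * ‖x' - x‖ :=
      add_le_add ((h2 x' z' z).trans (mul_le_mul_of_nonneg_left h hL)) (h1 z x' x)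
    _ = _ := by ring

/-- One inexact gradient step, with the error of the search direction split in two parts. -/
theorem descent_of_inexact_gradient {E : Type*} [NormedAddCommGroup E] [InnerProductSpace ℝ E]
    {Φ Φ' L α a b : ℝ} {g d x x' : E} (hα : 0 < α) (hx' : x' = x - α • d)
    (hq : Φ' ≤ Φ + inner ℝ g (x' - x) + L / 2 * ‖x' - x‖ ^ 2) (hd : ‖d - g‖ ≤ a + b) :
    Φ' - Φ ≤ -(α / 2) * ‖g‖ ^ 2 - 1 / 2 * (1 / α - L) * ‖x' - x‖ ^ 2 + α * a ^ 2 + α * b ^ 2 := by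
  have e : x' - x = -(α • d) := by rw [hx']; abel
  have hn : ‖x' - x‖ ^ 2 = α ^ 2 * ‖d‖ ^ 2 := by
    rw [e, norm_neg, norm_smul, mul_pow, Real.norm_eq_abs, sq_abs]
  have hin : inner ℝ g (x' - x) = -(α * inner ℝ d g) := by
    rw [e, inner_neg_right, real_inner_smul_right, real_inner_comm]
  have hsq : ‖d - g‖ ^ 2 ≤ 2 * a ^ 2 + 2 * b ^ 2 := by
    have := pow_le_pow_left₀ (norm_nonneg _) hd 2
    nlinarith [sq_nonneg (a - b)]
  rw [norm_sub_sq_real] at hsq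
  have h3 : 1 / 2 * (1 / α - L) * ‖x' - x‖ ^ 2 = α / 2 * ‖d‖ ^ 2 - L / 2 * ‖x' - x‖ ^ 2 := by
    rw [hn]
    field_simp
  rw [h3]
  rw [hin] at hq
  nlinarith [mul_le_mul_of_nonneg_left hsq hα.le]

/-- Change of the upper-level value when the aggregation weight decreases from `μ` to `μ'`. -/
theorem upper_value_sub_le {F f : Eu n → Eu m → ℝ} (hF : Differentiable ℝ (Function.uncurry F))
    (hf : Differentiable ℝ (Function.uncurry f)) {σ μ μ' : ℝ} (hσ : 0 < σ) (hμ' : 0 < μ')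
    (hle : μ' ≤ μ) (hμ : μ ≤ 1 / 2) {x : Eu n} (hFc : StrongConvexOn univ σ (F x))
    (hfc : ConvexOn ℝ univ (f x)) {z w : Eu m} (hz : grady (aggreg μ' F f) x z = 0)
    (hw : grady (aggreg μ F f) x w = 0) :
    F x z - F x w ≤ (2 * ‖grady F x z‖ ^ 2 / σ) * ((μ - μ') / μ) := by
  have hμ0 : 0 < μ := hμ'.trans_le hle
  set g := grady F x z with hg
  set h := grady f x z with hh
  have hval : F x z - F x w ≤ ‖g‖ * ‖z - w‖ := by
    have h1 := hFc.add_inner_add_le (hasGradientAt_grady hF x z) w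
    rw [← neg_sub z w, inner_neg_right, ← hg] at h1
    have h2 := real_inner_le_norm g (z - w)
    have h3 : 0 ≤ σ / 2 * ‖-(z - w)‖ ^ 2 := by positivity
    linarith
  rw [grady_aggreg μ' hF hf, ← hg, ← hh] at hz
  have hres : (1 - μ') • grady (aggreg μ F f) x z = (μ - μ') • g := by
    rw [grady_aggreg μ hF hf, ← hg, ← hh]
    calc _ = (μ - μ') • g + (1 - μ) • (μ' • g + (1 - μ') • h) := by module
      _ = _ := by rw [hz, smul_zero, add_zero]
  have hnres : (1 - μ') * ‖grady (aggreg μ F f) x z‖ = (μ - μ') * ‖g‖ := by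
    have := congrArg norm hres
    rwa [norm_smul, norm_smul, Real.norm_of_nonneg (by linarith),
      Real.norm_of_nonneg (by linarith)] at this
  have hmono := strongMonotone_grady_aggreg hμ0.le (by linarith) hF hf hFc hfc z w
  rw [hw, sub_zero] at hmono
  have hdist : μ * σ * ‖z - w‖ ≤ ‖grady (aggreg μ F f) x z‖ := by
    rcases (norm_nonneg (z - w)).eq_or_lt with h0 | h0
    · rw [← h0, mul_zero]
      exact norm_nonneg _
    · refine le_of_mul_le_mul_right ?_ h0
      linarith [hmono.trans (real_inner_le_norm _ _)]
  have hdist' : ‖z - w‖ ≤ 2 * (μ - μ') * ‖g‖ / (μ * σ) := by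
    rw [le_div_iff₀ (mul_pos hμ0 hσ)]
    nlinarith [norm_nonneg (grady (aggreg μ F f) x z)]
  calc F x z - F x w ≤ ‖g‖ * (2 * (μ - μ') * ‖g‖ / (μ * σ)) :=
        hval.trans (mul_le_mul_of_nonneg_left hdist' (norm_nonneg _))
    _ = _ := by field_simp

end Estimates

/-- Lemma 3.9 / D.1: descent of the approximate overall upper-level
objective `Φ_μ(x) = F(x, y*_μ(x))` along the sl-BAMM `x`-update. -/
theorem descent_of_aggregated_objective {n m : ℕ}
    (F f : Eu n → Eu m → ℝ)
    (hF : ContDiff ℝ 2 (Function.uncurry F))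
    (hf : ContDiff ℝ 2 (Function.uncurry f))
    (LFx1 LFx2 LFy1 LFy2 Lfy1 Lfy2 LFxy1 LFxy2 Lfxy1 Lfxy2 LFyy1 LFyy2 Lfyy1 Lfyy2 : ℝ≥0)
    (hLFx1 : ∀ y, LipschitzWith LFx1 fun x => gradx F x y)
    (hLFx2 : ∀ x, LipschitzWith LFx2 fun y => gradx F x y)
    (hLFy1 : ∀ y, LipschitzWith LFy1 fun x => grady F x y)
    (hLFy2 : ∀ x, LipschitzWith LFy2 fun y => grady F x y)
    (hLfy1 : ∀ y, LipschitzWith Lfy1 fun x => grady f x y)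
    (hLfy2 : ∀ x, LipschitzWith Lfy2 fun y => grady f x y)
    (hLFxy1 : ∀ y, LipschitzWith LFxy1 fun x => hessxy F x y)
    (hLFxy2 : ∀ x, LipschitzWith LFxy2 fun y => hessxy F x y)
    (hLfxy1 : ∀ y, LipschitzWith Lfxy1 fun x => hessxy f x y)
    (hLfxy2 : ∀ x, LipschitzWith Lfxy2 fun y => hessxy f x y)
    (hLFyy1 : ∀ y, LipschitzWith LFyy1 fun x => hessyy F x y)
    (hLFyy2 : ∀ x, LipschitzWith LFyy2 fun y => hessyy F x y)
    (hLfyy1 : ∀ y, LipschitzWith Lfyy1 fun x => hessyy f x y)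
    (hLfyy2 : ∀ x, LipschitzWith Lfyy2 fun y => hessyy f x y)
    (σF : ℝ) (hσF : 0 < σF)
    (hFsc : ∀ x, StrongConvexOn univ σF (F x))
    (hfconv : ∀ x, ConvexOn ℝ univ (f x))
    (ystar : ℝ → Eu n → Eu m)
    (hmin : ∀ μ' ∈ Ioc (0 : ℝ) 1, ∀ x y,
      aggreg μ' F f x (ystar μ' x) ≤ aggreg μ' F f x y)
    (vstar : ℝ → Eu n → Eu m)
    (hvstar : ∀ μ' x, vstar μ' x =
      (hessyy (aggreg μ' F f) x (ystar μ' x)).inverse (grady F x (ystar μ' x)))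
    (μ μplus : ℝ) (hμplus : 0 < μplus) (hle : μplus ≤ μ) (hμhalf : μ ≤ 1 / 2)
    (σψ : ℝ) (hσψ : σψ = μ * σF)
    (Lψy1 Lψxy1 Lψxy2 Lψyy1 Lψyy2 CΦ1 CΦ2 : ℝ)
    (hLψy1 : Lψy1 = μ * LFy1 + (1 - μ) * Lfy1)
    (hLψxy1 : Lψxy1 = μ * LFxy1 + (1 - μ) * Lfxy1)
    (hLψxy2 : Lψxy2 = μ * LFxy2 + (1 - μ) * Lfxy2)
    (hLψyy1 : Lψyy1 = μ * LFyy1 + (1 - μ) * Lfyy1)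
    (hLψyy2 : Lψyy2 = μ * LFyy2 + (1 - μ) * Lfyy2)
    (hCΦ1 : CΦ1 = Lψy1 ^ 2 * Lψyy2 + Lψy1 * (Lψyy1 + Lψxy2) * σψ + Lψxy1 * σψ ^ 2)
    (hCΦ2 : CΦ2 = Lψy1 ^ 2 * LFy2 + Lψy1 * (LFy1 + LFx2) * σψ + LFx1 * σψ ^ 2)
    (α : ℝ) (hα : 0 < α)
    (x : Eu n) (y v : Eu m) (xp : Eu n)
    (hxp : xp = x - α • (gradx F x y - hessxy (aggreg μ F f) x y v)) :
    F xp (ystar μplus xp) - F x (ystar μ x) ≤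
      -(α / 2) * ‖gradient (fun x' => F x' (ystar μ x')) x‖ ^ 2
      - (1 / 2) * (1 / α - (CΦ1 * ‖vstar μ x‖ + CΦ2) / σψ ^ 2) * ‖xp - x‖ ^ 2
      + α * (Lψxy2 * ‖vstar μ x‖ + LFx2) ^ 2 * ‖y - ystar μ x‖ ^ 2
      + α * Lψy1 ^ 2 * ‖v - vstar μ x‖ ^ 2
      + (2 * ‖grady F xp (ystar μplus xp)‖ ^ 2 / σF) * ((μ - μplus) / μ) := by
  have hμ0 : 0 < μ := hμplus.trans_le hle
  have hμ1 : μ ≤ 1 := by linarith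
  have hσ : 0 < σψ := hσψ ▸ mul_pos hμ0 hσF
  have h1μ : 0 ≤ 1 - μ := by linarith
  have hdF : Differentiable ℝ (Function.uncurry F) := hF.differentiable (by norm_num)
  have hdf : Differentiable ℝ (Function.uncurry f) := hf.differentiable (by norm_num)
  set ψ := aggreg μ F f with hψdef
  have hψ : ContDiff ℝ 2 (Function.uncurry ψ) := contDiff_aggreg μ hF hf
  set Y := ystar μ with hYdef
  have hY : ∀ x, grady ψ x (Y x) = 0 := fun x =>
    grady_eq_zero_of_forall_le (hmin μ ⟨hμ0, hμ1⟩ x)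
  have hmono : ∀ x z w,
      σψ * ‖z - w‖ ^ 2 ≤ inner ℝ (grady ψ x z - grady ψ x w) (z - w) := fun x z w =>
    hσψ ▸ strongMonotone_grady_aggreg hμ0.le hμ1 hdF hdf (hFsc x) (hfconv x) z w
  have hcoer : ∀ x u, σψ * ‖u‖ ^ 2 ≤ inner ℝ (hessyy ψ x (Y x) u) u := fun x =>
    le_inner_fderiv_of_strongMonotone (hasFDerivAt_grady_right hψ x (Y x))
      fun z => hmono x z (Y x)
  have hinv : ∀ x, (hessyy ψ x (Y x)).IsInvertible := fun x =>
    ContinuousLinearMap.isInvertible_of_le_inner hσ (hcoer x)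
  have hy1 : ∀ y x x', ‖grady ψ x y - grady ψ x' y‖ ≤ Lψy1 * ‖x - x'‖ := fun y x x' => by
    simpa only [hψdef, grady_aggreg μ hdF hdf, hLψy1] using
      norm_combo_sub_le hμ0.le hμ1 (hLFy1 y) (hLfy1 y) x x'
  have hxy1 : ∀ y x x', ‖hessxy ψ x y - hessxy ψ x' y‖ ≤ Lψxy1 * ‖x - x'‖ := fun y x x' => by
    simpa only [hψdef, hessxy_aggreg μ hF hf, hLψxy1] using
      norm_combo_sub_le hμ0.le hμ1 (hLFxy1 y) (hLfxy1 y) x x'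
  have hxy2 : ∀ x y y', ‖hessxy ψ x y - hessxy ψ x y'‖ ≤ Lψxy2 * ‖y - y'‖ := fun x y y' => by
    simpa only [hψdef, hessxy_aggreg μ hF hf, hLψxy2] using
      norm_combo_sub_le hμ0.le hμ1 (hLFxy2 x) (hLfxy2 x) y y'
  have hyy1 : ∀ y x x', ‖hessyy ψ x y - hessyy ψ x' y‖ ≤ Lψyy1 * ‖x - x'‖ := fun y x x' => by
    simpa only [hψdef, hessyy_aggreg μ hF hf, hLψyy1] using
      norm_combo_sub_le hμ0.le hμ1 (hLFyy1 y) (hLfyy1 y) x x'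
  have hyy2 : ∀ x y y', ‖hessyy ψ x y - hessyy ψ x y'‖ ≤ Lψyy2 * ‖y - y'‖ := fun x y y' => by
    simpa only [hψdef, hessyy_aggreg μ hF hf, hLψyy2] using
      norm_combo_sub_le hμ0.le hμ1 (hLFyy2 x) (hLfyy2 x) y y'
  have hLy1 : 0 ≤ Lψy1 := by rw [hLψy1]; positivity
  have hLxy2 : 0 ≤ Lψxy2 := by rw [hLψxy2]; positivity
  have hLyy2 : 0 ≤ Lψyy2 := by rw [hLψyy2]; positivity
  have hgrad : ∀ x, HasGradientAt (fun x' => F x' (Y x')) (gradx F x (Y x) -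
      hessxy ψ x (Y x) ((hessyy ψ x (Y x)).inverse (grady F x (Y x)))) x :=
    hasGradientAt_comp_solution hdF hψ hσ hmono hy1 hY
  have hv := hvstar μ x
  rw [← hψdef, ← hYdef] at hv
  have hHnorm : ∀ x y, ‖hessxy ψ x y‖ ≤ Lψy1 := fun x y => norm_hessxy_le hLy1 y (hy1 y) x
  have hgradlip : ∀ z, ‖(gradx F z (Y z) -
        hessxy ψ z (Y z) ((hessyy ψ z (Y z)).inverse (grady F z (Y z)))) -
      (gradx F x (Y x) - hessxy ψ x (Y x) ((hessyy ψ x (Y x)).inverse (grady F x (Y x))))‖ ≤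
      (CΦ1 * ‖vstar μ x‖ + CΦ2) / σψ ^ 2 * ‖z - x‖ := fun z => by
    have hYz := norm_solution_sub_le hσ hmono hy1 hY z x
    refine (norm_sub_apply_inverse_sub_le hσ (hinv x) (hinv z) (hcoer z)
      (norm_sub_le_of_partial LFx2.coe_nonneg (fun y => (hLFx1 y).norm_sub_le)
        (fun x => (hLFx2 x).norm_sub_le) hYz)
      (norm_sub_le_of_partial LFy2.coe_nonneg (fun y => (hLFy1 y).norm_sub_le)
        (fun x => (hLFy2 x).norm_sub_le) hYz)
      (norm_sub_le_of_partial hLyy2 hyy1 hyy2 hYz)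
      (norm_sub_le_of_partial hLxy2 hxy1 hxy2 hYz) (hHnorm z (Y z))).trans_eq ?_
    rw [← hv, hCΦ1, hCΦ2]
    field_simp
    ring
  have hquad := le_add_inner_add_of_norm_gradient_sub_le hgrad hgradlip xp
  have hdir : ‖(gradx F x y - hessxy ψ x y v) - (gradx F x (Y x) -
      hessxy ψ x (Y x) ((hessyy ψ x (Y x)).inverse (grady F x (Y x))))‖ ≤
      (Lψxy2 * ‖vstar μ x‖ + LFx2) * ‖y - Y x‖ + Lψy1 * ‖v - vstar μ x‖ := by
    rw [← hv]
    have e : (gradx F x y - hessxy ψ x y v) - (gradx F x (Y x) - hessxy ψ x (Y x) (vstar μ x)) =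
        (gradx F x y - gradx F x (Y x)) - (hessxy ψ x y - hessxy ψ x (Y x)) (vstar μ x) -
          hessxy ψ x y (v - vstar μ x) := by
      simp only [map_sub, sub_apply]
      abel
    have h1 := (hLFx2 x).norm_sub_le y (Y x)
    have h2 := ContinuousLinearMap.le_of_opNorm_le _ (hxy2 x y (Y x)) (vstar μ x)
    have h3 := (hessxy ψ x y).le_of_opNorm_le (hHnorm x y) (v - vstar μ x)
    rw [e]
    refine (norm_sub_le _ _).trans ((add_le_add_left (norm_sub_le _ _) _).trans ?_)
    linarith
  have hdesc := descent_of_inexact_gradient hα hxp hquad hdir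
  have hshift := upper_value_sub_le hdF hdf hσF hμplus hle hμhalf (hFsc xp) (hfconv xp)
    (grady_eq_zero_of_forall_le (hmin μplus ⟨hμplus, hle.trans hμ1⟩ xp)) (hY xp)
  rw [(hgrad x).gradient]
  rw [mul_pow, mul_pow] at hdesc
  linarith
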